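/- Let σ, τ be weight functions in the class W₀ with associated weight matrices {S^(ℓ) : ℓ > 0} and {T^(ℓ) : ℓ > 0}, and assume γ(σ) > 0 and γ(τ) > 0. Then for all ℓ, ℓ₁, j, j₁ > 0 one has γ(ω_{S^(ℓ)}) + γ(ω_{T^(j)}) = γ(σ) + γ(τ) ≤ γ(σ⋆̌τ) = γ(ω_{S^(ℓ₁)} ⋆̌ ω_{T^(j₁)}). -/

import Mathlib

open Real Filter Asymptotics Set
open scoped ENNReal Topology

noncomputable section

/-- A weight function: nonnegative, non-decreasing on `[0,∞)`, tending to `+∞`. -/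
def IsWeightFct (ω : ℝ → ℝ) : Prop :=
  (∀ t : ℝ, 0 ≤ ω t) ∧ MonotoneOn ω (Ici (0:ℝ)) ∧ Tendsto ω atTop atTop

/-- Condition `(ω₁)`: `ω(2t) = O(ω(t))`. -/
def HasOm1 (ω : ℝ → ℝ) : Prop :=
  ∃ L : ℝ, 1 ≤ L ∧ ∀ t : ℝ, 0 ≤ t → ω (2 * t) ≤ L * (ω t + 1)

/-- Condition `(ω₆)`. -/
def HasOm6 (ω : ℝ → ℝ) : Prop :=
  ∃ H : ℝ, 1 ≤ H ∧ ∀ t : ℝ, 0 ≤ t → 2 * ω t ≤ ω (H * t) + H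

/-- The class `W₀` of (normalized) Braun-Meise-Taylor weight functions. -/
def IsW0 (ω : ℝ → ℝ) : Prop :=
  IsWeightFct ω ∧ ContinuousOn ω (Ici (0:ℝ)) ∧ (∀ t ∈ Icc (0:ℝ) 1, ω t = 0) ∧
    ((fun t : ℝ => Real.log t) =o[atTop] ω) ∧
    ConvexOn ℝ univ (fun y : ℝ => ω (Real.exp y))

/-- Legendre-Fenchel-Young conjugate `φ*_ω`. -/
def phiStar (ω : ℝ → ℝ) (x : ℝ) : ℝ :=
  sSup {z : ℝ | ∃ y : ℝ, 0 ≤ y ∧ z = x * y - ω (Real.exp y)}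

/-- The sequence `W^(ℓ)` of the associated weight matrix of `ω`. -/
def assocSeq (ω : ℝ → ℝ) (ℓ : ℝ) (p : ℕ) : ℝ :=
  Real.exp ((1 / ℓ) * phiStar ω (ℓ * (p : ℝ)))

/-- The weight function `ω_M` associated with a sequence `M`. -/
def omegaSeq (M : ℕ → ℝ) (t : ℝ) : ℝ :=
  sSup {z : ℝ | ∃ p : ℕ, z = Real.log (t ^ p / M p)}

/-- Property `(P_{ω,γ})`. -/
def gammaProp (ω : ℝ → ℝ) (g : ℝ) : Prop :=
  ∃ K : ℝ, 1 < K ∧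
    limsup (fun t : ℝ => ((ω (K ^ g * t) / ω t : ℝ) : EReal)) atTop < (K : EReal)

/-- Property `(P̄_{ω,γ})`. -/
def gammaBarProp (ω : ℝ → ℝ) (g : ℝ) : Prop :=
  ∃ A : ℝ, 1 < A ∧
    (A : EReal) < liminf (fun t : ℝ => ((ω (A ^ g * t) / ω t : ℝ) : EReal)) atTop

/-- The growth index `γ(ω) ∈ [0,∞]`. -/
def gammaIdx (ω : ℝ → ℝ) : ℝ≥0∞ :=
  ⨆ (g : ℝ) (_ : 0 < g ∧ gammaProp ω g), ENNReal.ofReal g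

/-- The growth index `γ̄(ω) ∈ [0,∞]` (`+∞` if no admissible `γ` exists). -/
def gammaBarIdx (ω : ℝ → ℝ) : ℝ≥0∞ :=
  sInf (ENNReal.ofReal '' {g : ℝ | 0 < g ∧ gammaBarProp ω g})

/-- Generalized lower Legendre conjugate `σ ⋆̌ τ`. -/
def lowerConj (σ τ : ℝ → ℝ) (t : ℝ) : ℝ :=
  sInf {z : ℝ | ∃ s : ℝ, 0 < s ∧ z = σ s + τ (t / s)}

/-- Generalized upper Legendre conjugate `σ ⋆̂ τ`. -/
def upperConj (σ τ : ℝ → ℝ) (t : ℝ) : ℝ :=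
  if t = 0 then σ 0 - τ 0 else sSup {z : ℝ | ∃ s : ℝ, 0 ≤ s ∧ z = σ s - τ (s / t)}

/-- `σ ⋆̂ τ` is well-defined, i.e. `σ⋆̂τ(t) < +∞` for every `t`. -/
def UpperConjWD (σ τ : ℝ → ℝ) : Prop :=
  ∀ t : ℝ, 0 < t → BddAbove {z : ℝ | ∃ s : ℝ, 0 ≤ s ∧ z = σ s - τ (s / t)}

/-- Lower Legendre envelope `h_⋆`. -/
def lowerEnv (h : ℝ → ℝ) (t : ℝ) : ℝ :=
  sInf {z : ℝ | ∃ u : ℝ, 0 < u ∧ z = h u + t * u}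

/-- Upper Legendre envelope `h^⋆`. -/
def upperEnv (h : ℝ → ℝ) (t : ℝ) : ℝ :=
  sSup {z : ℝ | ∃ s : ℝ, 0 ≤ s ∧ z = h s - t * s}

/-- `(((ω^ι)^α)_⋆)^{1/α}` (which equals `ω ⋆̌ id^{1/α}`). -/
def lowerCompose (ω : ℝ → ℝ) (α : ℝ) (t : ℝ) : ℝ :=
  lowerEnv (fun u : ℝ => ω (1 / u ^ α)) (t ^ (1 / α))

/-- `(((ω^α)^⋆)^ι)^{1/α}` (which equals `ω ⋆̂ id^{1/α}`). -/
def upperCompose (ω : ℝ → ℝ) (α : ℝ) (t : ℝ) : ℝ :=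
  upperEnv (fun s : ℝ => ω (s ^ α)) (1 / t ^ (1 / α))

/-- Equivalence `σ ∼ τ` of weight functions. -/
def WeightEquiv (σ τ : ℝ → ℝ) : Prop :=
  σ =O[atTop] τ ∧ τ =O[atTop] σ

/-- Relation `M ≼ N` for sequences: `sup_{p ≥ 1} (M_p/N_p)^{1/p} < ∞`. -/
def seqPrec (M N : ℕ → ℝ) : Prop :=
  ∃ C : ℝ, ∀ p : ℕ, 1 ≤ p → (M p / N p) ^ (1 / (p : ℝ)) ≤ C

/-- Relation `M ◁ N` for sequences: `(M_p/N_p)^{1/p} → 0`. -/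
def seqTriangle (M N : ℕ → ℝ) : Prop :=
  Tendsto (fun p : ℕ => (M p / N p) ^ (1 / (p : ℝ))) atTop (𝓝 0)

/-- Equivalence `M ≈ N` of sequences. -/
def seqEquiv (M N : ℕ → ℝ) : Prop := seqPrec M N ∧ seqPrec N M

/-- The Gevrey sequence `G^α`. -/
def gevrey (α : ℝ) (p : ℕ) : ℝ := (p.factorial : ℝ) ^ α

/-- The quotient sequence `μ_p = M_p / M_{p-1}`, `μ₀ = 1`. -/
def quotSeq (M : ℕ → ℝ) : ℕ → ℝ
  | 0 => 1
  | (p + 1) => M (p + 1) / M p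

/-- Condition `(β,Q)`: `liminf_{p} μ_{Qp}/μ_p > Q^β`. -/
def condBQ (M : ℕ → ℝ) (β : ℝ) (Q : ℕ) : Prop :=
  ((((Q : ℝ) ^ β : ℝ)) : EReal) <
    liminf (fun p : ℕ => ((quotSeq M (Q * p) / quotSeq M p : ℝ) : EReal)) atTop

/-- Thilliez's growth index `γ(M) ∈ [0,∞]`. -/
def thilliezIdx (M : ℕ → ℝ) : ℝ≥0∞ :=
  ⨆ (β : ℝ) (_ : 0 ≤ β ∧ ∃ Q : ℕ, 2 ≤ Q ∧ condBQ M β Q), ENNReal.ofReal β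

/-- The Beurling Gelfand-Shilov space `S_(σ)(ℝ)` (membership predicate). -/
def MemSBeurling (σ : ℝ → ℝ) (f : ℝ → ℂ) : Prop :=
  ContDiff ℝ (⊤ : ℕ∞) f ∧ ∀ ℓ : ℝ, 0 < ℓ → ∃ C : ℝ, ∀ x : ℝ, ∀ j k : ℕ,
    (1 + |x|) ^ k * ‖iteratedDeriv j f x‖ ≤ C * assocSeq σ ℓ (j + k)

/-- The polynomial `ψ(x) = x² + 1/4`. -/
def psiMap (x : ℝ) : ℝ := x ^ 2 + 1 / 4

/-- The resolvent operator `R_μ = ∑_m C_{ψ_m}/μ^{m+1}`. -/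
def Rres (μ : ℂ) (f : ℝ → ℂ) (x : ℝ) : ℂ :=
  ∑' m : ℕ, (μ ^ (m + 1))⁻¹ * f (psiMap^[m] x)

/-- Nonnegative, non-decreasing functions on `[0,∞)` that tend to infinity; the values at negative
arguments are irrelevant. -/
structure IsGrowthFct (f : ℝ → ℝ) : Prop where
  nonneg : ∀ t, 0 ≤ t → 0 ≤ f t
  mono : MonotoneOn f (Ici (0 : ℝ))
  tendsto : Tendsto f atTop atTop

/-- `f` is bounded on `[0,∞)` by an affine function of `g`. -/
def AffineDominated (f g : ℝ → ℝ) : Prop :=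
  ∃ C D : ℝ, 0 ≤ C ∧ ∀ t, 0 ≤ t → f t ≤ C * g t + D

namespace IsGrowthFct

variable {f g : ℝ → ℝ}

/-- An eventual bound for a non-decreasing function extends to `[0,∞)` with an additive constant. -/
theorem exists_affine_bound (hf : IsGrowthFct f) {a C : ℝ} (ha : 0 ≤ a) (hC : 0 ≤ C)
    (h : ∀ᶠ t in atTop, f (a * t) ≤ C * f t) :
    ∃ D, ∀ t, 0 ≤ t → f (a * t) ≤ C * f t + D := by
  obtain ⟨T, hT⟩ := eventually_atTop.1 h
  have hT₀ : 0 ≤ max T 0 := le_max_right _ _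
  have hD : 0 ≤ f (a * max T 0) := hf.nonneg _ (by positivity)
  refine ⟨f (a * max T 0), fun t ht => ?_⟩
  rcases le_total (max T 0) t with h' | h'
  · linarith [hT t ((le_max_left _ _).trans h')]
  · have h1 : f (a * t) ≤ f (a * max T 0) :=
      hf.mono (mem_Ici.2 (by positivity)) (mem_Ici.2 (by positivity))
        (mul_le_mul_of_nonneg_left h' ha)
    have h2 : 0 ≤ C * f t := mul_nonneg hC (hf.nonneg t ht)
    linarith

theorem exists_affine_bound_of_gammaProp (hf : IsGrowthFct f) {γ : ℝ} (h : gammaProp f γ) :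
    ∃ K K' D : ℝ, 1 < K ∧ 0 < K' ∧ K' < K ∧ ∀ t, 0 ≤ t → f (K ^ γ * t) ≤ K' * f t + D := by
  obtain ⟨K, hK, hlim⟩ := h
  obtain ⟨b, hb, hbK⟩ := EReal.lt_iff_exists_real_btwn.1 hlim
  have hbK' : b < K := by exact_mod_cast hbK
  have hpos : 0 < max b (1 / 2) := lt_max_of_lt_right (by norm_num)
  have hev : ∀ᶠ t in atTop, f (K ^ γ * t) ≤ max b (1 / 2) * f t := by
    filter_upwards [eventually_lt_of_limsup_lt hb, hf.tendsto.eventually_gt_atTop 0] with t ht ht₀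
    have h1 : f (K ^ γ * t) / f t < b := by exact_mod_cast ht
    have h2 := (div_lt_iff₀ ht₀).1 h1
    have h3 := mul_le_mul_of_nonneg_right (le_max_left b (1 / 2)) ht₀.le
    linarith
  obtain ⟨D, hD⟩ := hf.exists_affine_bound (by positivity) hpos.le hev
  exact ⟨K, _, D, hK, hpos, max_lt hbK' (by linarith), hD⟩

/-- If `γ < γ(f)` then, for every `ε > 0`, `f (H ^ γ t)` is at most `ε H f(t)` up to an additive
constant, for all large `H`. -/
theorem exists_scaling_bound (hf : IsGrowthFct f) {γ : ℝ} (hγ : 0 < γ) (h : gammaProp f γ)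
    {ε : ℝ} (hε : 0 < ε) :
    ∃ H₀ : ℝ, 1 < H₀ ∧ ∀ H, H₀ ≤ H → ∃ D, ∀ t, 0 ≤ t → f (H ^ γ * t) ≤ ε * H * f t + D := by
  obtain ⟨K, K', D, hK, hK'₀, hK', hbound⟩ := hf.exists_affine_bound_of_gammaProp h
  have hK₀ : 0 < K := by linarith
  have hiter : ∀ n : ℕ, ∃ E, ∀ t, 0 ≤ t → f ((K ^ n) ^ γ * t) ≤ K' ^ n * f t + E := by
    intro n
    induction n with
    | zero => exact ⟨0, fun t _ => by simp⟩
    | succ n ih =>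
      obtain ⟨E, hE⟩ := ih
      refine ⟨K' ^ n * D + E, fun t ht => ?_⟩
      have h1 := hE (K ^ γ * t) (by positivity)
      have h2 := mul_le_mul_of_nonneg_left (hbound t ht) (pow_nonneg hK'₀.le n)
      have h3 : (K ^ (n + 1)) ^ γ * t = (K ^ n) ^ γ * (K ^ γ * t) := by
        rw [pow_succ, Real.mul_rpow (by positivity) hK₀.le, mul_assoc]
      rw [h3, pow_succ]
      linarith
  have hq : K' / K < 1 := (div_lt_one hK₀).2 hK'
  obtain ⟨N, hN⟩ := exists_pow_lt_of_lt_one (div_pos hε hK'₀) hq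
  refine ⟨K ^ (N + 1), one_lt_pow₀ hK (by simp), fun H hH => ?_⟩
  have hH₁ : 1 ≤ H := (one_le_pow₀ hK.le).trans hH
  obtain ⟨n, hn, hn'⟩ := exists_nat_pow_near hH₁ hK
  have hNn : N ≤ n := by
    have := (pow_lt_pow_iff_right₀ hK).1 (hH.trans_lt hn')
    omega
  obtain ⟨E, hE⟩ := hiter (n + 1)
  refine ⟨E, fun t ht => ?_⟩
  have hfactor : K' ^ (n + 1) ≤ ε * H := by
    have h1 : (K' / K) ^ n ≤ ε / K' :=
      (pow_le_pow_of_le_one (by positivity) hq.le hNn).trans hN.le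
    rw [div_pow, div_le_div_iff₀ (by positivity) hK'₀] at h1
    calc K' ^ (n + 1) = K' ^ n * K' := pow_succ _ _
      _ ≤ ε * K ^ n := h1
      _ ≤ ε * H := mul_le_mul_of_nonneg_left hn hε.le
  have hmono : f (H ^ γ * t) ≤ f ((K ^ (n + 1)) ^ γ * t) := by
    refine hf.mono (mem_Ici.2 (by positivity)) (mem_Ici.2 (by positivity)) ?_
    gcongr
  have h2 := mul_le_mul_of_nonneg_right hfactor (hf.nonneg t ht)
  linarith [hE t ht]

theorem gammaProp_of_scaling_bound (hf : IsGrowthFct f) {γ K K' D : ℝ} (hK : 1 < K)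
    (hK' : K' < K) (h : ∀ t, 0 ≤ t → f (K ^ γ * t) ≤ K' * f t + D) : gammaProp f γ := by
  refine ⟨K, hK, lt_of_le_of_lt (b := (((K' + K) / 2 : ℝ) : EReal)) ?_ ?_⟩
  · refine limsup_le_of_le (h := ?_)
    filter_upwards [hf.tendsto.eventually_gt_atTop 0, eventually_ge_atTop 0,
      hf.tendsto.eventually_ge_atTop (D / ((K - K') / 2))] with t ht₀ ht hD
    rw [div_le_iff₀ (by linarith)] at hD
    refine EReal.coe_le_coe_iff.2 ((div_le_iff₀ ht₀).2 ?_)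
    linarith [h t ht]
  · exact EReal.coe_lt_coe_iff.2 (by linarith)

theorem gammaProp_congr (hf : IsGrowthFct f) (hg : IsGrowthFct g) (hfg : AffineDominated f g)
    (hgf : AffineDominated g f) {γ : ℝ} (hγ : 0 < γ) (h : gammaProp f γ) : gammaProp g γ := by
  obtain ⟨C, D, hC, hCD⟩ := hfg
  obtain ⟨C', D', hC', hCD'⟩ := hgf
  obtain ⟨H, hH₁, hH⟩ := hf.exists_scaling_bound hγ h (ε := 1 / (C' * C + 1)) (by positivity)
  obtain ⟨E, hE⟩ := hH H le_rfl
  have hH₀ : 0 < H := by linarith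
  set ε : ℝ := 1 / (C' * C + 1) with hε
  have hε₀ : 0 < ε := by positivity
  refine hg.gammaProp_of_scaling_bound (K := H) (K' := C' * (ε * H * C))
    (D := C' * (ε * H * D + E) + D') hH₁ ?_ fun t ht => ?_
  · have h1 : C' * C * ε < 1 := by
      rw [hε, mul_one_div, div_lt_one (by positivity)]
      linarith
    nlinarith
  · have h1 := hCD' (H ^ γ * t) (by positivity)
    have h2 := mul_le_mul_of_nonneg_left (hE t ht) hC'
    have h3 := mul_le_mul_of_nonneg_left
      (mul_le_mul_of_nonneg_left (hCD t ht) (mul_pos hε₀ hH₀).le) hC'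
    linarith

theorem gammaIdx_congr (hf : IsGrowthFct f) (hg : IsGrowthFct g) (hfg : AffineDominated f g)
    (hgf : AffineDominated g f) : gammaIdx f = gammaIdx g := by
  refine le_antisymm ?_ ?_
  · exact iSup₂_le fun γ h => le_iSup₂_of_le γ
      ⟨h.1, hf.gammaProp_congr hg hfg hgf h.1 h.2⟩ le_rfl
  · exact iSup₂_le fun γ h => le_iSup₂_of_le γ
      ⟨h.1, hg.gammaProp_congr hf hgf hfg h.1 h.2⟩ le_rfl

theorem tendsto_of_affineDominated {f g : ℝ → ℝ} (hf : Tendsto f atTop atTop)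
    (h : AffineDominated f g) : Tendsto g atTop atTop := by
  obtain ⟨C, D, hC, hCD⟩ := h
  refine tendsto_atTop.2 fun b => ?_
  filter_upwards [hf.eventually_gt_atTop (C * b + D), eventually_ge_atTop 0] with t ht ht₀
  by_contra! hlt
  linarith [hCD t ht₀, mul_le_mul_of_nonneg_left hlt.le hC]

theorem lowerConj_set_bddBelow (hf : IsGrowthFct f) (hg : IsGrowthFct g) {t : ℝ} (ht : 0 ≤ t) :
    BddBelow {z : ℝ | ∃ s : ℝ, 0 < s ∧ z = f s + g (t / s)} := by
  refine ⟨0, ?_⟩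
  rintro z ⟨s, hs, rfl⟩
  exact add_nonneg (hf.nonneg s hs.le) (hg.nonneg _ (by positivity))

theorem lowerConj_le (hf : IsGrowthFct f) (hg : IsGrowthFct g) {t s : ℝ} (ht : 0 ≤ t)
    (hs : 0 < s) : lowerConj f g t ≤ f s + g (t / s) :=
  csInf_le (hf.lowerConj_set_bddBelow hg ht) ⟨s, hs, rfl⟩

theorem le_lowerConj {f g : ℝ → ℝ} {t c : ℝ} (h : ∀ s, 0 < s → c ≤ f s + g (t / s)) :
    c ≤ lowerConj f g t := by
  refine le_csInf ⟨_, 1, one_pos, rfl⟩ ?_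
  rintro z ⟨s, hs, rfl⟩
  exact h s hs

theorem lowerConj_isGrowthFct (hf : IsGrowthFct f) (hg : IsGrowthFct g) :
    IsGrowthFct (lowerConj f g) where
  nonneg t ht := le_lowerConj fun s hs =>
    add_nonneg (hf.nonneg s hs.le) (hg.nonneg _ (by positivity))
  mono := by
    intro t ht u hu htu
    have ht₀ : 0 ≤ t := ht
    have hu₀ : 0 ≤ u := hu
    refine le_lowerConj fun s hs => (hf.lowerConj_le hg ht₀ hs).trans ?_
    have := hg.mono (mem_Ici.2 (by positivity)) (mem_Ici.2 (by positivity))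
      (div_le_div_of_nonneg_right htu hs.le)
    linarith
  tendsto := by
    have hmin : Tendsto (fun t => min (f (√t)) (g (√t))) atTop atTop := by
      refine tendsto_atTop.2 fun b => ?_
      filter_upwards [(hf.tendsto.comp tendsto_sqrt_atTop).eventually_ge_atTop b,
        (hg.tendsto.comp tendsto_sqrt_atTop).eventually_ge_atTop b] with t h1 h2
      exact le_min h1 h2
    refine tendsto_atTop_mono' _ ?_ hmin
    filter_upwards [eventually_ge_atTop 0] with t ht
    refine le_lowerConj fun s hs => ?_
    have hfs := hf.nonneg s hs.le
    have hgs := hg.nonneg (t / s) (by positivity)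
    rcases le_total (√t) s with h | h
    · have := hf.mono (mem_Ici.2 (sqrt_nonneg t)) (mem_Ici.2 hs.le) h
      linarith [min_le_left (f (√t)) (g (√t))]
    · have h' : √t ≤ t / s := by
        rw [le_div_iff₀ hs]
        nlinarith [Real.mul_self_sqrt ht, sqrt_nonneg t]
      have := hg.mono (mem_Ici.2 (sqrt_nonneg t)) (mem_Ici.2 (by positivity)) h'
      linarith [min_le_right (f (√t)) (g (√t))]

/-- Scaled affine bounds for `f` and `g` give one for their lower Legendre conjugate. -/
theorem lowerConj_scaled_le (hf : IsGrowthFct f) (hg : IsGrowthFct g) {f' g' : ℝ → ℝ}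
    {a b C D E : ℝ} (ha : 0 < a) (hb : 0 < b) (hC : 0 < C)
    (hff' : ∀ t, 0 ≤ t → f (a * t) ≤ C * f' t + D)
    (hgg' : ∀ t, 0 ≤ t → g (b * t) ≤ C * g' t + E) {t : ℝ} (ht : 0 ≤ t) :
    lowerConj f g (a * b * t) ≤ C * lowerConj f' g' t + (D + E) := by
  rw [← sub_le_iff_le_add, ← div_le_iff₀' hC]
  refine le_lowerConj fun s hs => ?_
  rw [div_le_iff₀' hC]
  have h1 := hf.lowerConj_le hg (t := a * b * t) (by positivity) (mul_pos ha hs)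
  have h2 : a * b * t / (a * s) = b * (t / s) := by
    field_simp
  rw [h2] at h1
  linarith [hff' s hs.le, hgg' (t / s) (by positivity)]

theorem lowerConj_affineDominated (hf : IsGrowthFct f) (hg : IsGrowthFct g) {f' g' : ℝ → ℝ}
    (hf' : IsGrowthFct f') (hg' : IsGrowthFct g')
    (hff' : AffineDominated f f') (hgg' : AffineDominated g g') :
    AffineDominated (lowerConj f g) (lowerConj f' g') := by
  obtain ⟨C, D, hC, hCD⟩ := hff'
  obtain ⟨C', D', hC', hCD'⟩ := hgg'
  refine ⟨C + C' + 1, D + D', by positivity, fun t ht => ?_⟩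
  have := hf.lowerConj_scaled_le hg (f' := f') (g' := g') (a := 1) (b := 1) (C := C + C' + 1)
    (D := D) (E := D') one_pos one_pos (by positivity) (fun s hs => ?_) (fun s hs => ?_) ht
  · simpa using this
  · rw [one_mul]
    nlinarith [hCD s hs, hf'.nonneg s hs]
  · rw [one_mul]
    nlinarith [hCD' s hs, hg'.nonneg s hs]

theorem gammaProp_lowerConj (hf : IsGrowthFct f) (hg : IsGrowthFct g) {γ δ : ℝ} (hγ : 0 < γ)
    (hδ : 0 < δ) (hfγ : gammaProp f γ) (hgδ : gammaProp g δ) :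
    gammaProp (lowerConj f g) (γ + δ) := by
  obtain ⟨H₁, hH₁, h₁⟩ := hf.exists_scaling_bound hγ hfγ (ε := 1 / 2) (by norm_num)
  obtain ⟨H₂, hH₂, h₂⟩ := hg.exists_scaling_bound hδ hgδ (ε := 1 / 2) (by norm_num)
  obtain ⟨D, hD⟩ := h₁ (max H₁ H₂) (le_max_left _ _)
  obtain ⟨E, hE⟩ := h₂ (max H₁ H₂) (le_max_right _ _)
  have hH : 1 < max H₁ H₂ := lt_max_of_lt_left hH₁
  have hH₀ : 0 < max H₁ H₂ := by linarith
  refine (hf.lowerConj_isGrowthFct hg).gammaProp_of_scaling_bound (K' := 1 / 2 * max H₁ H₂)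
    (D := D + E) hH (by linarith) fun t ht => ?_
  rw [Real.rpow_add hH₀]
  exact hf.lowerConj_scaled_le hg (by positivity) (by positivity) (by positivity) hD hE ht

theorem gammaIdx_add_le_lowerConj (hf : IsGrowthFct f) (hg : IsGrowthFct g)
    (hγf : 0 < gammaIdx f) (hγg : 0 < gammaIdx g) :
    gammaIdx f + gammaIdx g ≤ gammaIdx (lowerConj f g) := by
  have hex : ∀ {h : ℝ → ℝ}, 0 < gammaIdx h → ∃ γ : ℝ, 0 < γ ∧ gammaProp h γ := by
    intro h hh
    by_contra! hne
    refine hh.ne' (le_antisymm (iSup₂_le fun γ hγ => ?_) zero_le)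
    exact absurd hγ.2 (hne γ hγ.1)
  refine ENNReal.biSup_add_biSup_le' (hex hγf) (hex hγg) fun γ hγ δ hδ => ?_
  rw [← ENNReal.ofReal_add hγ.1.le hδ.1.le]
  exact le_iSup₂_of_le (γ + δ)
    ⟨add_pos hγ.1 hδ.1, hf.gammaProp_lowerConj hg hγ.1 hδ.1 hγ.2 hδ.2⟩ le_rfl

end IsGrowthFct

/-- A convex function on the line has a supporting line at every point. -/
theorem ConvexOn.exists_supporting_slope {φ : ℝ → ℝ} (hφ : ConvexOn ℝ univ φ) (y : ℝ) :
    ∃ x, ∀ z, φ y + x * (z - y) ≤ φ z := by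
  refine ⟨derivWithin φ (Ioi y) y, fun z => ?_⟩
  have hy : y ∈ interior (univ : Set ℝ) := by simp
  rcases lt_trichotomy z y with h | rfl | h
  · have h1 := (hφ.slope_le_leftDeriv_of_mem_interior (mem_univ z) hy h).trans
      (hφ.leftDeriv_le_rightDeriv_of_mem_interior hy)
    rw [slope_def_field, div_le_iff₀ (by linarith)] at h1
    linarith
  · simp
  · have h1 := hφ.rightDeriv_le_slope_of_mem_interior hy (mem_univ z) h
    rw [slope_def_field, le_div_iff₀ (by linarith)] at h1
    linarith

namespace IsW0

variable {ω : ℝ → ℝ}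

theorem isGrowthFct (hω : IsW0 ω) : IsGrowthFct ω :=
  ⟨fun t _ => hω.1.1 t, hω.1.2.1, hω.1.2.2⟩

theorem exists_mul_log_le (hω : IsW0 ω) {c : ℝ} (hc : 0 < c) :
    ∃ T, 1 ≤ T ∧ ∀ t, T ≤ t → c * log t ≤ ω t := by
  obtain ⟨T, hT⟩ := eventually_atTop.1 (hω.2.2.2.1.bound (inv_pos.2 hc))
  refine ⟨max T 1, le_max_right _ _, fun t ht => ?_⟩
  have h1 := hT t ((le_max_left _ _).trans ht)
  rw [Real.norm_eq_abs, Real.norm_eq_abs, abs_of_nonneg (hω.1.1 t), inv_mul_eq_div,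
    le_div_iff₀' hc] at h1
  exact (mul_le_mul_of_nonneg_left (le_abs_self _) hc.le).trans h1

theorem phiStar_set_bddAbove (hω : IsW0 ω) {x : ℝ} (hx : 0 ≤ x) :
    BddAbove {z : ℝ | ∃ y : ℝ, 0 ≤ y ∧ z = x * y - ω (exp y)} := by
  obtain ⟨T, hT₁, hT⟩ := hω.exists_mul_log_le (c := x + 1) (by positivity)
  have hlogT : 0 ≤ log T := log_nonneg hT₁
  refine ⟨x * log T, ?_⟩
  rintro z ⟨y, hy, rfl⟩
  rcases le_total T (exp y) with h | h
  · have h1 := hT _ h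
    rw [log_exp] at h1
    nlinarith [mul_nonneg hx hlogT]
  · have h1 : y ≤ log T := (le_log_iff_exp_le (by linarith)).2 h
    linarith [mul_le_mul_of_nonneg_left h1 hx, hω.1.1 (exp y)]

theorem le_phiStar (hω : IsW0 ω) {x y : ℝ} (hx : 0 ≤ x) (hy : 0 ≤ y) :
    x * y - ω (exp y) ≤ phiStar ω x :=
  le_csSup (hω.phiStar_set_bddAbove hx) ⟨y, hy, rfl⟩

theorem phiStar_le {ω : ℝ → ℝ} {x c : ℝ} (h : ∀ y, 0 ≤ y → x * y - ω (exp y) ≤ c) :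
    phiStar ω x ≤ c := by
  refine csSup_le ⟨_, 0, le_rfl, rfl⟩ ?_
  rintro z ⟨y, hy, rfl⟩
  exact h y hy

theorem phiStar_nonneg (hω : IsW0 ω) {x : ℝ} (hx : 0 ≤ x) : 0 ≤ phiStar ω x := by
  simpa [hω.2.2.1 1 (by simp)] using hω.le_phiStar hx le_rfl

theorem phiStar_zero (hω : IsW0 ω) : phiStar ω 0 = 0 :=
  le_antisymm (phiStar_le fun y _ => by simpa using hω.1.1 (exp y)) (hω.phiStar_nonneg le_rfl)

theorem assocSeq_zero (hω : IsW0 ω) (ℓ : ℝ) : assocSeq ω ℓ 0 = 1 := by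
  simp [assocSeq, hω.phiStar_zero]

theorem log_pow_div_assocSeq {ω : ℝ → ℝ} {ℓ t : ℝ} (ht : 0 < t) (p : ℕ) :
    log (t ^ p / assocSeq ω ℓ p) = p * log t - 1 / ℓ * phiStar ω (ℓ * p) := by
  rw [assocSeq, log_div (by positivity) (exp_pos _).ne', log_pow, log_exp]

theorem log_zero_pow_div_assocSeq (hω : IsW0 ω) (ℓ : ℝ) (p : ℕ) :
    log (0 ^ p / assocSeq ω ℓ p) = 0 := by
  rcases p with _ | p
  · simp [hω.assocSeq_zero]
  · simp

theorem log_pow_div_assocSeq_le (hω : IsW0 ω) {ℓ t : ℝ} (hℓ : 0 < ℓ) (ht : 0 ≤ t) (p : ℕ) :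
    log (t ^ p / assocSeq ω ℓ p) ≤ ω t / ℓ := by
  have hωt : 0 ≤ ω t := hω.1.1 t
  rcases ht.eq_or_lt with rfl | ht₀
  · rw [hω.log_zero_pow_div_assocSeq]
    positivity
  · have hp : 0 ≤ ℓ * (p : ℝ) := by positivity
    rw [log_pow_div_assocSeq ht₀, le_div_iff₀ hℓ]
    have h1 : (p * log t - 1 / ℓ * phiStar ω (ℓ * p)) * ℓ
        = ℓ * p * log t - phiStar ω (ℓ * p) := by
      field_simp
    rw [h1]
    rcases le_total 1 t with h | h
    · have h2 := hω.le_phiStar hp (log_nonneg h)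
      rw [exp_log ht₀] at h2
      linarith
    · have h2 := mul_nonpos_of_nonneg_of_nonpos hp (log_nonpos ht h)
      linarith [hω.phiStar_nonneg hp]

theorem omegaSeq_set_bddAbove (hω : IsW0 ω) {ℓ t : ℝ} (hℓ : 0 < ℓ) (ht : 0 ≤ t) :
    BddAbove {z : ℝ | ∃ p : ℕ, z = log (t ^ p / assocSeq ω ℓ p)} := by
  refine ⟨ω t / ℓ, ?_⟩
  rintro z ⟨p, rfl⟩
  exact hω.log_pow_div_assocSeq_le hℓ ht p

theorem le_omegaSeq_assocSeq (hω : IsW0 ω) {ℓ t : ℝ} (hℓ : 0 < ℓ) (ht : 0 ≤ t) (p : ℕ) :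
    log (t ^ p / assocSeq ω ℓ p) ≤ omegaSeq (assocSeq ω ℓ) t :=
  le_csSup (hω.omegaSeq_set_bddAbove hℓ ht) ⟨p, rfl⟩

theorem omegaSeq_assocSeq_le {ω : ℝ → ℝ} {ℓ t c : ℝ}
    (h : ∀ p : ℕ, log (t ^ p / assocSeq ω ℓ p) ≤ c) : omegaSeq (assocSeq ω ℓ) t ≤ c := by
  refine csSup_le ⟨_, 0, rfl⟩ ?_
  rintro z ⟨p, rfl⟩
  exact h p

theorem omegaSeq_assocSeq_nonneg (hω : IsW0 ω) {ℓ t : ℝ} (hℓ : 0 < ℓ) (ht : 0 ≤ t) :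
    0 ≤ omegaSeq (assocSeq ω ℓ) t := by
  simpa [hω.assocSeq_zero] using hω.le_omegaSeq_assocSeq hℓ ht 0

theorem le_mul_omegaSeq_assocSeq_add_log (hω : IsW0 ω) {ℓ t : ℝ} (hℓ : 0 < ℓ) (ht : 1 ≤ t) :
    ω t ≤ ℓ * omegaSeq (assocSeq ω ℓ) t + ℓ * log t := by
  have ht₀ : 0 < t := by linarith
  have hlog : 0 ≤ log t := log_nonneg ht
  obtain ⟨x, hx⟩ := hω.2.2.2.2.exists_supporting_slope (log t)
  simp only [exp_log ht₀] at hx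
  have hx₀ : 0 ≤ x := by
    have h1 := hx (log t - 1)
    have h2 : ω (exp (log t - 1)) ≤ ω t := by
      refine hω.1.2.1 (mem_Ici.2 (exp_pos _).le) (mem_Ici.2 ht₀.le) ?_
      calc exp (log t - 1) ≤ exp (log t) := exp_le_exp.2 (by linarith)
        _ = t := exp_log ht₀
    linarith
  set p := ⌊x / ℓ⌋₊ with hp
  have hpx : ℓ * p ≤ x := by
    have := Nat.floor_le (div_nonneg hx₀ hℓ.le)
    rwa [le_div_iff₀' hℓ] at this
  have hxp : x < ℓ * p + ℓ := by
    have := Nat.lt_floor_add_one (x / ℓ)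
    rw [div_lt_iff₀' hℓ] at this
    linarith
  have hφ : phiStar ω (ℓ * p) ≤ x * log t - ω t := phiStar_le fun y hy => by
    linarith [mul_le_mul_of_nonneg_right hpx hy, hx y]
  have h1 := hω.le_omegaSeq_assocSeq hℓ ht₀.le p
  rw [log_pow_div_assocSeq ht₀] at h1
  have h2 := mul_le_mul_of_nonneg_left h1 hℓ.le
  have h3 : ℓ * (p * log t - 1 / ℓ * phiStar ω (ℓ * p)) = ℓ * p * log t - phiStar ω (ℓ * p) := by
    field_simp
  linarith [mul_le_mul_of_nonneg_right hxp.le hlog]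

theorem omegaSeq_assocSeq_affineDominated (hω : IsW0 ω) {ℓ : ℝ} (hℓ : 0 < ℓ) :
    AffineDominated (omegaSeq (assocSeq ω ℓ)) ω := by
  refine ⟨1 / ℓ, 0, by positivity, fun t ht => omegaSeq_assocSeq_le fun p => ?_⟩
  have := hω.log_pow_div_assocSeq_le hℓ ht p
  rwa [add_zero, one_div_mul_eq_div]

theorem affineDominated_omegaSeq_assocSeq (hω : IsW0 ω) {ℓ : ℝ} (hℓ : 0 < ℓ) :
    AffineDominated ω (omegaSeq (assocSeq ω ℓ)) := by
  obtain ⟨T, hT₁, hT⟩ := hω.exists_mul_log_le (c := 2 * ℓ) (by positivity)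
  refine ⟨2 * ℓ, ω T, by positivity, fun t ht => ?_⟩
  rcases le_total T t with h | h
  · linarith [hω.le_mul_omegaSeq_assocSeq_add_log hℓ (hT₁.trans h), hT t h, hω.1.1 T]
  · have h1 := hω.1.2.1 (mem_Ici.2 ht) (mem_Ici.2 (by linarith)) h
    have h2 := mul_nonneg hℓ.le (hω.omegaSeq_assocSeq_nonneg hℓ ht)
    linarith

theorem omegaSeq_assocSeq_isGrowthFct (hω : IsW0 ω) {ℓ : ℝ} (hℓ : 0 < ℓ) :
    IsGrowthFct (omegaSeq (assocSeq ω ℓ)) where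
  nonneg _ ht := hω.omegaSeq_assocSeq_nonneg hℓ ht
  mono := by
    intro s hs t ht hst
    have hs' : 0 ≤ s := hs
    refine omegaSeq_assocSeq_le fun p => ?_
    rcases hs'.eq_or_lt with rfl | hs₀
    · rw [hω.log_zero_pow_div_assocSeq]
      exact hω.omegaSeq_assocSeq_nonneg hℓ ht
    · refine le_trans ?_ (hω.le_omegaSeq_assocSeq hℓ ht p)
      have hpos : 0 < assocSeq ω ℓ p := exp_pos _
      refine log_le_log (by positivity) ?_
      gcongr
  tendsto := IsGrowthFct.tendsto_of_affineDominated hω.1.2.2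
    (hω.affineDominated_omegaSeq_assocSeq hℓ)

theorem gammaIdx_omegaSeq_assocSeq (hω : IsW0 ω) {ℓ : ℝ} (hℓ : 0 < ℓ) :
    gammaIdx (omegaSeq (assocSeq ω ℓ)) = gammaIdx ω :=
  (hω.omegaSeq_assocSeq_isGrowthFct hℓ).gammaIdx_congr hω.isGrowthFct
    (hω.omegaSeq_assocSeq_affineDominated hℓ) (hω.affineDominated_omegaSeq_assocSeq hℓ)

end IsW0

theorem stmt0 (σ τ : ℝ → ℝ) (hσ : IsW0 σ) (hτ : IsW0 τ)
    (hγσ : 0 < gammaIdx σ) (hγτ : 0 < gammaIdx τ) :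
    ∀ ℓ : ℝ, 0 < ℓ → ∀ ℓ₁ : ℝ, 0 < ℓ₁ → ∀ j : ℝ, 0 < j → ∀ j₁ : ℝ, 0 < j₁ →
      gammaIdx (omegaSeq (assocSeq σ ℓ)) + gammaIdx (omegaSeq (assocSeq τ j))
          = gammaIdx σ + gammaIdx τ ∧
      gammaIdx σ + gammaIdx τ ≤ gammaIdx (lowerConj σ τ) ∧
      gammaIdx (lowerConj σ τ)
          = gammaIdx (lowerConj (omegaSeq (assocSeq σ ℓ₁)) (omegaSeq (assocSeq τ j₁))) := by
  intro ℓ hℓ ℓ₁ hℓ₁ j hj j₁ hj₁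
  have gσ := hσ.isGrowthFct
  have gτ := hτ.isGrowthFct
  have gS := hσ.omegaSeq_assocSeq_isGrowthFct hℓ₁
  have gT := hτ.omegaSeq_assocSeq_isGrowthFct hj₁
  refine ⟨?_, gσ.gammaIdx_add_le_lowerConj gτ hγσ hγτ, ?_⟩
  · rw [hσ.gammaIdx_omegaSeq_assocSeq hℓ, hτ.gammaIdx_omegaSeq_assocSeq hj]
  · exact (gσ.lowerConj_isGrowthFct gτ).gammaIdx_congr (gS.lowerConj_isGrowthFct gT)
      (gσ.lowerConj_affineDominated gτ gS gT (hσ.affineDominated_omegaSeq_assocSeq hℓ₁)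
        (hτ.affineDominated_omegaSeq_assocSeq hj₁))
      (gS.lowerConj_affineDominated gT gσ gτ (hσ.omegaSeq_assocSeq_affineDominated hℓ₁)
        (hτ.omegaSeq_assocSeq_affineDominated hj₁))
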